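/- Let S = ℤ² ∖ {(1,1), (−1,−1)} and define φ : S → M₂(ℂ) by: φ(0,0) = the identity matrix, φ(1,0) = the matrix with 1 in the (2,1) entry and 0 elsewhere, φ(0,1) = the matrix with 1 in the (1,2) entry and 0 elsewhere, φ(−1,0) = φ(1,0)*, φ(0,−1) = φ(0,1)*, and φ(g) = 0 for all other g ∈ S. Then there is no positive definite function Φ : ℤ² → M₂(ℂ) with Φ(s) = φ(s) for all s ∈ S. -/

import Mathlib

set_option linter.unusedVariables false

open scoped ComplexOrder Pointwise InnerProductSpace BoundedContinuousFunction

/-- The set `S = ℤ² ∖ {(1,1), (−1,−1)}`. -/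
def Sphi : Set (ℤ × ℤ) := {((1 : ℤ), (1 : ℤ)), ((-1 : ℤ), (-1 : ℤ))}ᶜ

/-- The function `φ : S → M₂(ℂ)`: identity at `0`, the elementary matrix `E₂₁` at `(1,0)`,
`E₁₂` at `(0,1)`, their adjoints at the inverses, `0` elsewhere. -/
noncomputable def phiFn : ℤ × ℤ → Matrix (Fin 2) (Fin 2) ℂ := fun g =>
  if g = (0, 0) then 1
  else if g = (1, 0) then Matrix.of ![![0, 0], ![1, 0]]
  else if g = (0, 1) then Matrix.of ![![0, 1], ![0, 0]]
  else if g = (-1, 0) then Matrix.conjTranspose (Matrix.of ![![0, 0], ![1, 0]])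
  else if g = (0, -1) then Matrix.conjTranspose (Matrix.of ![![0, 1], ![0, 0]])
  else 0

/-- `φ` admits no positive definite extension to `ℤ²`. -/
theorem phiFn_no_extension :
    ¬ ∃ Φ : ℤ × ℤ → Matrix (Fin 2) (Fin 2) ℂ,
      (∀ (n : ℕ) (g : Fin n → ℤ × ℤ),
        (Matrix.of fun p q : Fin n × Fin 2 => Φ (g q.1 - g p.1) p.2 q.2).PosSemidef) ∧
      ∀ s ∈ Sphi, Φ s = phiFn s := by
  rintro ⟨Φ, hΦ, hS⟩
  have value : ∀ a b : ℤ, ((a, b) ≠ (1, 1) ∧ (a, b) ≠ (-1, -1)) → Φ (a, b) = phiFn (a, b) :=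
    fun a b h => hS _ (by simpa [Sphi] using h)
  have upper := (hΦ 3 ![(0, 0), (0, 1), (1, 2)]).dotProduct_mulVec_nonneg
    (fun p => ![![2, 0], ![0, -2], ![0, 1]] p.1 p.2)
  have lower := (hΦ 3 ![(0, 1), (1, 1), (1, 2)]).dotProduct_mulVec_nonneg
    (fun p => ![![0, 2], ![-2, 0], ![0, 1]] p.1 p.2)
  simp [dotProduct, Matrix.mulVec, Fintype.sum_prod_type, Fin.sum_univ_succ, value, phiFn,
    Complex.le_def] at upper lower
  linarith [upper.1, lower.1]
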